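/- Let k be a field and A = (A_1, …, A_p), B = (B_1, …, B_p) two p-tuples of n×n matrices over k. Then A and B are simultaneously similar if and only if for every p-tuple Y = (Y_1, …, Y_p) of n×n matrices over k, the rank of the k-linear map 𝓛(A, Y) equals the rank of the k-linear map 𝓛(B, Y). -/

import Mathlib

open Matrix

/-- The `k`-linear map `𝓛(A, C) : k^{n×n} → (k^{n×n})^p`, `Z ↦ (Z A_i − C_i Z)_{i ∈ [p]}`. -/
def LMap {k : Type*} [Field k] {n p : ℕ}
    (A C : Fin p → Matrix (Fin n) (Fin n) k) :
    Matrix (Fin n) (Fin n) k →ₗ[k] (Fin p → Matrix (Fin n) (Fin n) k) where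
  toFun Z := fun i => Z * A i - C i * Z
  map_add' := by
    intro a b
    funext i
    simp only [Pi.add_apply, Matrix.add_mul, Matrix.mul_add]
    abel
  map_smul' := by
    intro c a
    funext i
    simp [Pi.smul_apply, Matrix.smul_mul, Matrix.mul_smul, smul_sub]

section HomDimension

open Module

section Ring

variable {R : Type*} [Ring R] {U M N : Type*} [AddCommGroup U] [Module R U]
  [AddCommGroup M] [Module R M] [AddCommGroup N] [Module R N]

/-- A retract splits off as a direct summand. -/
noncomputable def LinearMap.equivProdKerOfRetract (a : U →ₗ[R] N) (b : N →ₗ[R] U)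
    (h : ∀ u, b (a u) = u) : (U × LinearMap.ker b) ≃ₗ[R] N :=
  LinearEquiv.ofBijective (a.coprod (LinearMap.ker b).subtype) <| by
    constructor
    · rw [injective_iff_map_eq_zero]
      rintro ⟨u, z, hz⟩ huz
      have hu : u = 0 := by
        have := congrArg b huz
        simpa [h, LinearMap.mem_ker.1 hz] using this
      subst hu
      simpa using huz
    · intro y
      exact ⟨(b y, ⟨y - a (b y), by simp [h]⟩), by simp⟩

/-- If `M` and `N` generate each other, some composite `M → N → M` is not nilpotent. -/
theorem exists_not_isNilpotent_comp [Nontrivial M] [Module.Finite (End R M) M]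
    (hMN : ⨆ f : M →ₗ[R] N, LinearMap.range f = ⊤)
    (hNM : ⨆ g : N →ₗ[R] M, LinearMap.range g = ⊤) :
    ∃ (f : M →ₗ[R] N) (g : N →ₗ[R] M), ¬ IsNilpotent (g ∘ₗ f : End R M) := by
  by_contra! hnil
  obtain ⟨m, hm, -⟩ :=
    (eq_top_or_exists_le_coatom (⊥ : Submodule (End R M) M)).resolve_left bot_ne_top
  have hmem (f : M →ₗ[R] N) (g : N →ₗ[R] M) (x : M) : g (f x) ∈ m := by
    by_contra hx
    have htop : m ⊔ Submodule.span (End R M) {g (f x)} = ⊤ :=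
      hm.2 _ (left_lt_sup.2 fun hle => hx (hle (Submodule.mem_span_singleton_self _)))
    obtain ⟨y, hy, z, hz, hyz⟩ := Submodule.mem_sup.1 (htop ▸ Submodule.mem_top : x ∈ _)
    obtain ⟨e, rfl⟩ := Submodule.mem_span_singleton.1 hz
    obtain ⟨w, hw⟩ := (hnil f (e ∘ₗ g)).isUnit_one_sub
    have hwx : (w : End R M) • x = y := by
      rw [hw, sub_smul, one_smul, sub_eq_iff_eq_add]
      exact hyz.symm
    have hxm : x ∈ m := by
      have := m.smul_mem (↑w⁻¹ : End R M) hy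
      rwa [← hwx, smul_smul, Units.inv_mul, one_smul] at this
    exact hx (m.smul_mem (g ∘ₗ f : End R M) hxm)
  have hg (g : N →ₗ[R] M) (y : N) : g y ∈ m := by
    have hy : y ∈ ⨆ f : M →ₗ[R] N, LinearMap.range f := hMN ▸ Submodule.mem_top
    induction hy using Submodule.iSup_induction' with
    | mem f _ hx => obtain ⟨x, rfl⟩ := hx; exact hmem f g x
    | zero => simp
    | add _ _ _ _ h₁ h₂ => rw [map_add]; exact m.add_mem h₁ h₂
  refine hm.1 (eq_top_iff.2 fun x _ => ?_)
  have hx : x ∈ ⨆ g : N →ₗ[R] M, LinearMap.range g := hNM ▸ Submodule.mem_top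
  induction hx using Submodule.iSup_induction' with
  | mem g _ hy => obtain ⟨y, rfl⟩ := hy; exact hg g y
  | zero => simp
  | add _ _ _ _ h₁ h₂ => exact m.add_mem (h₁ trivial) (h₂ trivial)

/-- Fitting decomposition: a non-nilpotent composite `M → N → M` yields a common nonzero
direct summand of `M` and `N`. -/
theorem exists_common_summand [IsNoetherian R M] [IsArtinian R M]
    (f : M →ₗ[R] N) (g : N →ₗ[R] M) (h : ¬ IsNilpotent (g ∘ₗ f : End R M)) :
    ∃ (U K : Submodule R M) (L : Submodule R N), U ≠ ⊥ ∧
      Nonempty ((U × K) ≃ₗ[R] M) ∧ Nonempty ((U × L) ≃ₗ[R] N) := by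
  set φ : End R M := g ∘ₗ f
  obtain ⟨m, hm⟩ := Filter.eventually_atTop.1 φ.eventually_isCompl_ker_pow_range_pow
  have hdis := (hm (m + 1) m.le_succ).disjoint
  set ψ : End R M := φ ^ (m + 1)
  have hinj (u : M) (hu : u ∈ LinearMap.range ψ) (h0 : ψ u = 0) : u = 0 :=
    Submodule.disjoint_def.1 hdis u h0 hu
  let θ : End R (LinearMap.range ψ) := ψ.rangeRestrict ∘ₗ ψ ∘ₗ (LinearMap.range ψ).subtype
  have hθ : Function.Injective θ := by
    rw [injective_iff_map_eq_zero]
    intro u hu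
    exact Subtype.ext (hinj u u.2 (hinj _ ⟨u, rfl⟩ (congrArg Subtype.val hu)))
  let e := LinearEquiv.ofBijective θ (IsArtinian.bijective_of_injective_endomorphism θ hθ)
  have he (u : LinearMap.range ψ) : e.symm (ψ.rangeRestrict (ψ u)) = u := e.symm_apply_apply u
  refine ⟨LinearMap.range ψ, _, _, fun h0 => h ⟨m + 1, LinearMap.range_eq_bot.1 h0⟩,
    ⟨LinearMap.equivProdKerOfRetract (LinearMap.range ψ).subtype
      (e.symm.toLinearMap ∘ₗ ψ.rangeRestrict ∘ₗ ψ) he⟩,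
    ⟨LinearMap.equivProdKerOfRetract (f ∘ₗ (LinearMap.range ψ).subtype)
      (e.symm.toLinearMap ∘ₗ ψ.rangeRestrict ∘ₗ (φ ^ m : End R M) ∘ₗ g) fun u => ?_⟩⟩
  have hu (x : M) : (φ ^ m : End R M) (g (f x)) = ψ x :=
    (LinearMap.congr_fun (pow_succ φ m) x).symm
  exact (congrArg (fun x => e.symm (ψ.rangeRestrict x)) (hu u)).trans (he u)

end Ring

section Algebra

universe v

variable {k : Type*} [Field k] {R : Type*} [Ring R] [Algebra k R]

section

variable {M N : Type*} [AddCommGroup M] [Module k M] [Module R M] [IsScalarTower k R M]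
  [AddCommGroup N] [Module k N] [Module R N] [IsScalarTower k R N]

instance LinearMap.finite_of_algebra [Module.Finite k M] [Module.Finite k N] :
    Module.Finite k (M →ₗ[R] N) :=
  Module.Finite.of_injective (LinearMap.restrictScalarsₗ k R M N k)
    (LinearMap.restrictScalars_injective k)

end

/-- Postcomposition with an `R`-linear equivalence, as a `k`-linear equivalence. -/
def LinearEquiv.homCongrRight {M N P : Type*} [AddCommGroup M] [Module R M]
    [AddCommGroup N] [Module k N] [Module R N] [IsScalarTower k R N]
    [AddCommGroup P] [Module k P] [Module R P] [IsScalarTower k R P] (e : N ≃ₗ[R] P) :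
    (M →ₗ[R] N) ≃ₗ[k] (M →ₗ[R] P) where
  __ := (LinearEquiv.refl R M).arrowCongrAddEquiv e
  map_smul' c f := LinearMap.ext fun x => (e.restrictScalars k).map_smul c (f x)

variable {n : ℕ}

theorem iSup_range_eq_top_of_finrank_hom_eq
    {M N : Type v} [AddCommGroup M] [Module k M] [Module R M] [IsScalarTower k R M]
    [AddCommGroup N] [Module k N] [Module R N] [IsScalarTower k R N]
    [Module.Finite k M] [Module.Finite k N]
    (hN : finrank k N ≤ n)
    (h : ∀ (X : Type v) [AddCommGroup X] [Module k X] [Module R X] [IsScalarTower k R X]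
      [Module.Finite k X], finrank k X ≤ n → finrank k (M →ₗ[R] X) = finrank k (N →ₗ[R] X)) :
    ⨆ f : M →ₗ[R] N, LinearMap.range f = ⊤ := by
  set I := ⨆ f : M →ₗ[R] N, LinearMap.range f
  have hfin : Module.Finite k I := inferInstanceAs (Module.Finite k (I.restrictScalars k))
  have hle : finrank k I ≤ n := (Submodule.finrank_le (I.restrictScalars k)).trans hN
  let ιM : (M →ₗ[R] I) →ₗ[k] (M →ₗ[R] N) :=
    { toFun f := I.subtype ∘ₗ f, map_add' _ _ := rfl, map_smul' _ _ := rfl }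
  let ιN : (N →ₗ[R] I) →ₗ[k] (N →ₗ[R] N) :=
    { toFun f := I.subtype ∘ₗ f, map_add' _ _ := rfl, map_smul' _ _ := rfl }
  have hιM : Function.Bijective ιM := by
    refine ⟨fun f g hfg => LinearMap.ext fun x => Subtype.ext (LinearMap.congr_fun hfg x),
      fun f => ⟨f.codRestrict I fun x => ?_, rfl⟩⟩
    exact Submodule.mem_iSup_of_mem f ⟨x, rfl⟩
  have hιN : Function.Injective ιN :=
    fun f g hfg => LinearMap.ext fun x => Subtype.ext (LinearMap.congr_fun hfg x)
  have heq : finrank k (N →ₗ[R] I) = finrank k (N →ₗ[R] N) := by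
    rw [← h I hle, ← h N hN]
    exact (LinearEquiv.ofBijective ιM hιM).finrank_eq
  obtain ⟨s, hs⟩ := (LinearMap.injective_iff_surjective_of_finrank_eq_finrank heq).1 hιN
    LinearMap.id
  refine eq_top_iff.2 fun x _ => ?_
  have hx : (s x : N) = x := LinearMap.congr_fun hs x
  exact hx ▸ (s x).2

/-- A form of the Auslander–Bongartz theorem: finite-dimensional modules of dimension at most `n`
are determined by the dimensions of their spaces of homomorphisms to modules of dimension at
most `n`. -/
theorem nonempty_linearEquiv_of_finrank_hom_eq
    {M N : Type v} [AddCommGroup M] [Module k M] [Module R M] [IsScalarTower k R M]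
    [AddCommGroup N] [Module k N] [Module R N] [IsScalarTower k R N]
    [Module.Finite k M] [Module.Finite k N]
    (hM : finrank k M ≤ n) (hN : finrank k N ≤ n)
    (h : ∀ (X : Type v) [AddCommGroup X] [Module k X] [Module R X] [IsScalarTower k R X]
      [Module.Finite k X], finrank k X ≤ n → finrank k (M →ₗ[R] X) = finrank k (N →ₗ[R] X)) :
    Nonempty (M ≃ₗ[R] N) := by
  induction hd : finrank k M using Nat.strong_induction_on generalizing M N with
  | _ d ih =>
  have hMN := iSup_range_eq_top_of_finrank_hom_eq hN h
  have hNM := iSup_range_eq_top_of_finrank_hom_eq hM fun X _ _ _ _ _ hX => (h X hX).symm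
  cases subsingleton_or_nontrivial M with
  | inl hsub =>
    have : Subsingleton N := by
      rw [← Submodule.subsingleton_iff R, ← subsingleton_iff_bot_eq_top, ← hMN, eq_comm, iSup_eq_bot]
      intro f
      rw [LinearMap.range_eq_bot]
      exact LinearMap.ext fun x => by rw [Subsingleton.elim x 0, map_zero, map_zero]
    exact ⟨0⟩
  | inr hnt =>
    have : IsNoetherian R M := isNoetherian_of_tower k inferInstance
    have : IsArtinian R M := isArtinian_of_tower k inferInstance
    have : Module.Finite (End R M) M := Module.Finite.of_restrictScalars_finite k _ _
    obtain ⟨f, g, hfg⟩ := exists_not_isNilpotent_comp hMN hNM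
    obtain ⟨U, K, L, hU, ⟨eM⟩, ⟨eN⟩⟩ := exists_common_summand f g hfg
    have : Module.Finite k U := inferInstanceAs (Module.Finite k (U.restrictScalars k))
    have : Module.Finite k K := inferInstanceAs (Module.Finite k (K.restrictScalars k))
    have : Module.Finite k L := inferInstanceAs (Module.Finite k (L.restrictScalars k))
    have hfM : finrank k U + finrank k K = finrank k M := by
      rw [← finrank_prod]; exact (eM.restrictScalars k).finrank_eq
    have hfN : finrank k U + finrank k L = finrank k N := by
      rw [← finrank_prod]; exact (eN.restrictScalars k).finrank_eq
    have : Nontrivial U := Submodule.nontrivial_iff_ne_bot.2 hU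
    have hpos : 0 < finrank k U := finrank_pos
    obtain ⟨e⟩ := ih (finrank k K) (by omega) (M := K) (N := L) (by omega) (by omega)
      (fun X _ _ _ _ _ hX => by
        have h1 := ((LinearMap.coprodEquiv (R := R) (M := U) (M₂ := K) (M₃ := X) k).trans
          (LinearEquiv.congrLeft X k eM)).finrank_eq
        have h2 := ((LinearMap.coprodEquiv (R := R) (M := U) (M₂ := L) (M₃ := X) k).trans
          (LinearEquiv.congrLeft X k eN)).finrank_eq
        rw [finrank_prod] at h1 h2
        have := h X hX
        omega) rfl
    exact ⟨eM.symm ≪≫ₗ (LinearEquiv.refl R U).prodCongr e ≪≫ₗ eN⟩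

end Algebra

end HomDimension

section TupleModule

open Module

universe u

/-- The representation of the free algebra on `p` generators on `kⁿ` in which the `i`-th generator
acts as `Y i`. -/
def TupleModule {k : Type u} [Field k] {n p : ℕ} (_Y : Fin p → Matrix (Fin n) (Fin n) k) : Type u :=
  Fin n → k

namespace TupleModule

variable {k : Type u} [Field k] {n p : ℕ} (Y : Fin p → Matrix (Fin n) (Fin n) k)

instance : AddCommGroup (TupleModule Y) := inferInstanceAs (AddCommGroup (Fin n → k))

instance : Module k (TupleModule Y) := inferInstanceAs (Module k (Fin n → k))

instance : Module.Finite k (TupleModule Y) := inferInstanceAs (Module.Finite k (Fin n → k))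

/-- The identity map from `kⁿ`, as a linear equivalence. -/
def equivFun : TupleModule Y ≃ₗ[k] (Fin n → k) := LinearEquiv.refl k (Fin n → k)

/-- The action of the free algebra on `TupleModule Y`. -/
def action : FreeAlgebra k (Fin p) →ₐ[k] End k (TupleModule Y) :=
  FreeAlgebra.lift k fun i => (equivFun Y).symm.conj (Matrix.toLin' (Y i))

instance : Module (FreeAlgebra k (Fin p)) (TupleModule Y) :=
  Module.compHom _ (action Y).toRingHom

theorem smul_def (r : FreeAlgebra k (Fin p)) (x : TupleModule Y) : r • x = action Y r x := rfl

theorem equivFun_ι_smul (i : Fin p) (x : TupleModule Y) :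
    equivFun Y (FreeAlgebra.ι k i • x) = Y i *ᵥ equivFun Y x := by
  simp [smul_def, action, LinearEquiv.conj_apply]

instance : IsScalarTower k (FreeAlgebra k (Fin p)) (TupleModule Y) :=
  ⟨fun c r x => by simp [smul_def]⟩

theorem finrank_eq : finrank k (TupleModule Y) = n := by
  rw [(equivFun Y).finrank_eq, finrank_fin_fun]

end TupleModule

section

variable {k : Type u} [Field k] {p : ℕ} {M N : Type*}
  [AddCommGroup M] [Module k M] [Module (FreeAlgebra k (Fin p)) M]
  [IsScalarTower k (FreeAlgebra k (Fin p)) M]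
  [AddCommGroup N] [Module k N] [Module (FreeAlgebra k (Fin p)) N]
  [IsScalarTower k (FreeAlgebra k (Fin p)) N]

/-- A linear map commuting with the generators is linear over the free algebra. -/
def LinearMap.ofCommuteGenerators (f : M →ₗ[k] N)
    (hf : ∀ (i : Fin p) x, f (FreeAlgebra.ι k i • x) = FreeAlgebra.ι k i • f x) :
    M →ₗ[FreeAlgebra k (Fin p)] N where
  toFun := f
  map_add' := f.map_add
  map_smul' r x := by
    dsimp only [RingHom.id_apply]
    induction r using FreeAlgebra.induction generalizing x with
    | grade0 c => simp only [algebraMap_smul, map_smul]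
    | grade1 i => exact hf i x
    | mul a b ha hb => simp only [mul_smul, ha, hb]
    | add a b ha hb => simp only [add_smul, map_add, ha, hb]

end

namespace TupleModule

variable {k : Type u} [Field k] {n p : ℕ}

/-- Homomorphisms of tuple modules are the matrices intertwining the tuples. -/
noncomputable def homEquivKer (A Y : Fin p → Matrix (Fin n) (Fin n) k) :
    (TupleModule A →ₗ[FreeAlgebra k (Fin p)] TupleModule Y) ≃ₗ[k] LinearMap.ker (LMap A Y) where
  toFun f := ⟨LinearMap.toMatrix' ((equivFun Y).toLinearMap ∘ₗ f.restrictScalars k ∘ₗ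
      (equivFun A).symm.toLinearMap), by
    refine LinearMap.mem_ker.2 (funext fun i => sub_eq_zero.2 (Matrix.toLin'.injective ?_))
    refine LinearMap.ext fun x => ?_
    have h1 := equivFun_ι_smul A i ((equivFun A).symm x)
    rw [LinearEquiv.apply_symm_apply, ← LinearEquiv.eq_symm_apply] at h1
    simp only [Matrix.toLin'_mul, Matrix.toLin'_toMatrix', LinearMap.comp_apply,
      Matrix.toLin'_apply, LinearEquiv.coe_coe, LinearMap.restrictScalars_apply]
    rw [← h1, map_smul, equivFun_ι_smul]⟩
  map_add' f g := Subtype.ext <| (congrArg LinearMap.toMatrix' (LinearMap.ext fun _ =>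
    (equivFun Y).map_add _ _)).trans (LinearMap.toMatrix'.map_add _ _)
  map_smul' c f := Subtype.ext <| (congrArg LinearMap.toMatrix' (LinearMap.ext fun _ =>
    (equivFun Y).map_smul c _)).trans (LinearMap.toMatrix'.map_smul c _)
  invFun Z := LinearMap.ofCommuteGenerators
    ((equivFun Y).symm.toLinearMap ∘ₗ Matrix.toLin' Z.1 ∘ₗ (equivFun A).toLinearMap) fun i x => by
      have hZ : Z.1 * A i = Y i * Z.1 := sub_eq_zero.1 (congrFun (LinearMap.mem_ker.1 Z.2) i)
      apply (equivFun Y).injective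
      simp only [LinearMap.comp_apply, LinearEquiv.coe_coe, LinearEquiv.apply_symm_apply,
        equivFun_ι_smul, Matrix.toLin'_apply, Matrix.mulVec_mulVec, hZ]
  left_inv f := by
    ext x
    simp [LinearMap.ofCommuteGenerators]
  right_inv Z := by
    apply Subtype.ext
    apply Matrix.toLin'.injective
    refine (Matrix.toLin'_toMatrix' _).trans (LinearMap.ext fun x => ?_)
    simp only [LinearMap.comp_apply, LinearEquiv.coe_coe, LinearMap.restrictScalars_apply]
    exact congrArg _ (congrArg _ ((equivFun A).apply_symm_apply x))

theorem finrank_hom_add_finrank_range (A Y : Fin p → Matrix (Fin n) (Fin n) k) :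
    finrank k (TupleModule A →ₗ[FreeAlgebra k (Fin p)] TupleModule Y) +
      finrank k (LinearMap.range (LMap A Y)) = finrank k (Matrix (Fin n) (Fin n) k) := by
  rw [(homEquivKer A Y).finrank_eq, add_comm, LinearMap.finrank_range_add_finrank_ker]

/-- Every `n`-dimensional representation of the free algebra comes from a tuple of matrices. -/
theorem exists_linearEquiv {X : Type*} [AddCommGroup X] [Module k X]
    [Module (FreeAlgebra k (Fin p)) X] [IsScalarTower k (FreeAlgebra k (Fin p)) X]
    [Module.Finite k X] (hX : finrank k X = n) :
    ∃ Y : Fin p → Matrix (Fin n) (Fin n) k,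
      Nonempty (X ≃ₗ[FreeAlgebra k (Fin p)] TupleModule Y) := by
  let b := (finBasisOfFinrankEq k X hX).equivFun
  let Y (i : Fin p) : Matrix (Fin n) (Fin n) k :=
    LinearMap.toMatrix' (b.conj (Algebra.lsmul k k X (FreeAlgebra.ι k i)))
  let f : X →ₗ[FreeAlgebra k (Fin p)] TupleModule Y :=
    LinearMap.ofCommuteGenerators ((equivFun Y).symm.toLinearMap ∘ₗ b.toLinearMap) fun i x => by
      apply (equivFun Y).injective
      rw [equivFun_ι_smul, ← Matrix.toLin'_apply, Matrix.toLin'_toMatrix']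
      simp [LinearEquiv.conj_apply]
  exact ⟨Y, ⟨LinearEquiv.ofBijective f ((b.trans (equivFun Y).symm).bijective)⟩⟩

theorem coe_homEquivKer (A Y : Fin p → Matrix (Fin n) (Fin n) k)
    (f : TupleModule A →ₗ[FreeAlgebra k (Fin p)] TupleModule Y) :
    (homEquivKer A Y f).1 = LinearMap.toMatrix' ((equivFun Y).toLinearMap ∘ₗ f.restrictScalars k ∘ₗ
      (equivFun A).symm.toLinearMap) := rfl

theorem homEquivKer_mul {A B C : Fin p → Matrix (Fin n) (Fin n) k}
    (g : TupleModule B →ₗ[FreeAlgebra k (Fin p)] TupleModule C)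
    (f : TupleModule A →ₗ[FreeAlgebra k (Fin p)] TupleModule B) :
    (homEquivKer B C g).1 * (homEquivKer A B f).1 = (homEquivKer A C (g ∘ₗ f)).1 := by
  rw [coe_homEquivKer, coe_homEquivKer, coe_homEquivKer, ← LinearMap.toMatrix'_comp]
  congr 1

theorem homEquivKer_id (A : Fin p → Matrix (Fin n) (Fin n) k) :
    (homEquivKer A A LinearMap.id).1 = 1 := by
  rw [coe_homEquivKer, ← LinearMap.toMatrix'_id]
  congr 1

/-- Isomorphism of tuple modules is simultaneous similarity. -/
theorem nonempty_linearEquiv_iff (A B : Fin p → Matrix (Fin n) (Fin n) k) :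
    Nonempty (TupleModule A ≃ₗ[FreeAlgebra k (Fin p)] TupleModule B) ↔
      ∃ S : GL (Fin n) k, ∀ i, B i = S.val * A i * S⁻¹.val := by
  constructor
  · rintro ⟨e⟩
    let S : GL (Fin n) k :=
      ⟨(homEquivKer A B e.toLinearMap).1, (homEquivKer B A e.symm.toLinearMap).1,
        by rw [homEquivKer_mul, LinearEquiv.comp_symm, homEquivKer_id],
        by rw [homEquivKer_mul, LinearEquiv.symm_comp, homEquivKer_id]⟩
    refine ⟨S, fun i => ?_⟩
    have h : S.val * A i = B i * S.val :=
      sub_eq_zero.1 (congrFun (LinearMap.mem_ker.1 (homEquivKer A B e.toLinearMap).2) i)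
    rw [h, mul_assoc, Units.mul_inv, mul_one]
  · rintro ⟨S, hS⟩
    let f : LinearMap.ker (LMap A B) := ⟨S.val,
      LinearMap.mem_ker.2 (funext fun i => sub_eq_zero.2 (by
        rw [hS, mul_assoc, Units.inv_mul, mul_one]))⟩
    let g : LinearMap.ker (LMap B A) := ⟨S⁻¹.val,
      LinearMap.mem_ker.2 (funext fun i => sub_eq_zero.2 (by
        rw [hS, ← mul_assoc, ← mul_assoc, Units.inv_mul, one_mul]))⟩
    refine ⟨LinearEquiv.ofLinearMap ((homEquivKer A B).symm f) ((homEquivKer B A).symm g)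
      ?_ ?_⟩
    · apply (homEquivKer B B).injective
      apply Subtype.ext
      rw [← homEquivKer_mul, homEquivKer_id, LinearEquiv.apply_symm_apply,
        LinearEquiv.apply_symm_apply]
      exact S.mul_inv
    · apply (homEquivKer A A).injective
      apply Subtype.ext
      rw [← homEquivKer_mul, homEquivKer_id, LinearEquiv.apply_symm_apply,
        LinearEquiv.apply_symm_apply]
      exact S.inv_mul

/-- Test modules of dimension exactly `n` detect homomorphism dimensions into all smaller ones. -/
theorem finrank_hom_eq_of_finrank_le {A B : Fin p → Matrix (Fin n) (Fin n) k}
    (h : ∀ Y : Fin p → Matrix (Fin n) (Fin n) k,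
      finrank k (TupleModule A →ₗ[FreeAlgebra k (Fin p)] TupleModule Y) =
        finrank k (TupleModule B →ₗ[FreeAlgebra k (Fin p)] TupleModule Y))
    (X : Type u) [AddCommGroup X] [Module k X]
    [Module (FreeAlgebra k (Fin p)) X] [IsScalarTower k (FreeAlgebra k (Fin p)) X]
    [Module.Finite k X] (hX : finrank k X ≤ n) :
    finrank k (TupleModule A →ₗ[FreeAlgebra k (Fin p)] X) =
      finrank k (TupleModule B →ₗ[FreeAlgebra k (Fin p)] X) := by
  have hn (X : Type u) [AddCommGroup X] [Module k X] [Module (FreeAlgebra k (Fin p)) X]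
      [IsScalarTower k (FreeAlgebra k (Fin p)) X] [Module.Finite k X] (hX : finrank k X = n) :
      finrank k (TupleModule A →ₗ[FreeAlgebra k (Fin p)] X) =
        finrank k (TupleModule B →ₗ[FreeAlgebra k (Fin p)] X) := by
    obtain ⟨Y, ⟨e⟩⟩ := exists_linearEquiv (p := p) hX
    rw [(e.homCongrRight (k := k)).finrank_eq, (e.homCongrRight (k := k)).finrank_eq, h Y]
  obtain rfl | hpos := n.eq_zero_or_pos
  · exact hn X (Nat.le_zero.1 hX)
  let T : Type u := TupleModule (k := k) (n := 1) (p := p) 0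
  have hT : finrank k T = 1 := finrank_eq _
  have hpi (Z : Type u) [AddCommGroup Z] [Module k Z] [Module (FreeAlgebra k (Fin p)) Z]
      [IsScalarTower k (FreeAlgebra k (Fin p)) Z] [Module.Finite k Z] (m : ℕ) :
      finrank k (Z →ₗ[FreeAlgebra k (Fin p)] (Fin m → T)) =
        m * finrank k (Z →ₗ[FreeAlgebra k (Fin p)] T) := by
    rw [← (LinearEquiv.linearMapPi (R := FreeAlgebra k (Fin p)) (M₂ := Z)
      (φ := fun _ : Fin m => T) k).finrank_eq, finrank_pi_fintype]
    simp
  have hT_eq : finrank k (TupleModule A →ₗ[FreeAlgebra k (Fin p)] T) =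
      finrank k (TupleModule B →ₗ[FreeAlgebra k (Fin p)] T) := by
    have := hn (Fin n → T) (by simp [finrank_pi_fintype, hT])
    rw [hpi, hpi] at this
    exact Nat.eq_of_mul_eq_mul_left hpos this
  have hprod := hn (X × (Fin (n - finrank k X) → T)) (by
    rw [finrank_prod, finrank_pi_fintype]
    simp [hT, hX])
  rw [← (LinearMap.prodEquiv k).finrank_eq, ← (LinearMap.prodEquiv k).finrank_eq, finrank_prod,
    finrank_prod, hpi, hpi, hT_eq] at hprod
  exact Nat.add_right_cancel hprod

end TupleModule

end TupleModule

/-- Two `p`-tuples of `n×n` matrices are simultaneously similar iff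
for every tuple `Y`, the ranks of the linear maps `𝓛(A, Y)` and `𝓛(B, Y)` coincide. -/
theorem stmt5 {k : Type*} [Field k] {n p : ℕ}
    (A B : Fin p → Matrix (Fin n) (Fin n) k) :
    (∃ S : GL (Fin n) k, ∀ i, B i = S.val * A i * S⁻¹.val) ↔
      ∀ Y : Fin p → Matrix (Fin n) (Fin n) k,
        Module.finrank k (LinearMap.range (LMap A Y)) =
          Module.finrank k (LinearMap.range (LMap B Y)) := by
  rw [← TupleModule.nonempty_linearEquiv_iff]
  constructor
  · rintro ⟨e⟩ Y
    have hA := TupleModule.finrank_hom_add_finrank_range A Y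
    have hB := TupleModule.finrank_hom_add_finrank_range B Y
    have := (LinearEquiv.congrLeft (TupleModule Y) k e).finrank_eq
    omega
  · intro h
    refine nonempty_linearEquiv_of_finrank_hom_eq (n := n) (TupleModule.finrank_eq A).le
      (TupleModule.finrank_eq B).le fun X _ _ _ _ _ hX =>
        TupleModule.finrank_hom_eq_of_finrank_le (fun Y => ?_) X hX
    have hA := TupleModule.finrank_hom_add_finrank_range A Y
    have hB := TupleModule.finrank_hom_add_finrank_range B Y
    have := h Y
    omega
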